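/- arXiv:2208.11423 — 4 statements merged into one kernel-verified Lean document; each statement's English description precedes it below -/
import Mathlib

section
/- Let n ≥ 1 be an integer and Q : ℝ → ℝ a measurable function such that t ↦ (1 + |t|)^{4n−1} e^{−Q(t²)} is integrable on ℝ. Let x₁, …, xₙ be strictly positive real numbers and w₁, …, wₙ real numbers such that, for every integer j with 0 ≤ j ≤ 2n − 1, ∫₀^∞ x^j · x^{−1/2} e^{−Q(x)} dx = Σ_{k=1}^n w_k · x_k^j. Then for every integer m with 0 ≤ m ≤ 4n − 1, ∫_{−∞}^∞ t^m e^{−Q(t²)} dt = Σ_{k=1}^n (w_k/2)·((√x_k)^m + (−√x_k)^m). In other words, the 2n-point symmetric rule with nodes ±√x_k and weights w_k/2 integrates all monomials of degree at most 4n − 1 exactly against the weight function e^{−Q(t²)} on the real line. -/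
open MeasureTheory

/-- The even moments of `W(t²)` on `ℝ` are the moments of `x^{-1/2} W(x)` on `(0,∞)`. -/
theorem integral_even_pow_mul_comp_sq (W : ℝ → ℝ) (j : ℕ) :
    ∫ t : ℝ, t ^ (2 * j) * W (t ^ 2)
      = ∫ s in Set.Ioi (0 : ℝ), s ^ j * s ^ (-(1 / 2) : ℝ) * W s := by
  have habs : ∫ t : ℝ, t ^ (2 * j) * W (t ^ 2)
      = ∫ t : ℝ, (fun u : ℝ => u ^ (2 * j) * W (u ^ 2)) |t| := by
    simp only [pow_mul, sq_abs]
  rw [habs, integral_comp_abs (f := fun u : ℝ => u ^ (2 * j) * W (u ^ 2)), ← integral_const_mul,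
    ← integral_comp_rpow_Ioi_of_pos (g := fun s : ℝ => s ^ j * s ^ (-(1 / 2) : ℝ) * W s)
      (p := 2) two_pos]
  refine setIntegral_congr_fun measurableSet_Ioi fun t ht => ?_
  have ht0 : (0 : ℝ) < t := ht
  have hsq : t ^ (2 : ℝ) = t ^ 2 := Real.rpow_two t
  have hinv : (t ^ 2) ^ (-(1 / 2) : ℝ) = t⁻¹ := by
    rw [Real.rpow_neg (by positivity), ← Real.sqrt_eq_rpow, Real.sqrt_sq ht0.le]
  have hone : t ^ ((2 : ℝ) - 1) = t := by norm_num
  simp only [smul_eq_mul, hsq, hinv, hone, pow_mul]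
  field_simp

/-- The odd moments of an even weight on `ℝ` vanish. -/
theorem integral_odd_pow_mul_comp_sq (W : ℝ → ℝ) {m : ℕ} (hm : Odd m) :
    ∫ t : ℝ, t ^ m * W (t ^ 2) = 0 := by
  have h := integral_neg_eq_self (fun t : ℝ => t ^ m * W (t ^ 2)) volume
  simp only [hm.neg_pow, neg_sq, neg_mul, integral_neg] at h
  linarith

/-- If the `n`-point rule `(x_k, w_k)` integrates `x^j` exactly against the weight
`x^{-1/2} e^{-Q(x)}` on `(0,∞)` for `0 ≤ j ≤ 2n−1`, then the symmetric `2n`-point rule with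
nodes `±√x_k` and weights `w_k/2` integrates `t^m` exactly against `e^{-Q(t²)}` on `ℝ`
for `0 ≤ m ≤ 4n−1`. -/
theorem stmt_4 (n : ℕ) (hn : 1 ≤ n) (Q : ℝ → ℝ) (hQmeas : Measurable Q)
    (hint : Integrable (fun t : ℝ => (1 + |t|) ^ (4 * n - 1) * Real.exp (-Q (t ^ 2))))
    (x w : Fin n → ℝ) (hx : ∀ k, 0 < x k)
    (hexact : ∀ j : ℕ, j ≤ 2 * n - 1 →
      ∫ s in Set.Ioi (0 : ℝ), s ^ j * s ^ (-(1 / 2) : ℝ) * Real.exp (-Q s)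
        = ∑ k, w k * (x k) ^ j) :
    ∀ m : ℕ, m ≤ 4 * n - 1 →
      ∫ t : ℝ, t ^ m * Real.exp (-Q (t ^ 2))
        = ∑ k, (w k / 2) * ((Real.sqrt (x k)) ^ m + (-Real.sqrt (x k)) ^ m) := by
  intro m hm
  rcases Nat.even_or_odd' m with ⟨j, rfl | rfl⟩
  · rw [integral_even_pow_mul_comp_sq (fun s => Real.exp (-Q s)), hexact j (by omega)]
    refine Finset.sum_congr rfl fun k _ => ?_
    rw [pow_mul, pow_mul, neg_sq, Real.sq_sqrt (hx k).le]
    ring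
  · have hodd : Odd (2 * j + 1) := odd_two_mul_add_one j
    rw [integral_odd_pow_mul_comp_sq (fun s => Real.exp (-Q s)) hodd]
    simp [hodd.neg_pow]
end

section
/- Let n ≥ 1 be an integer and Q : ℝ → ℝ a measurable function such that t ↦ (1 + |t|)^{4n+1} e^{−Q(t²)} is integrable on ℝ. Let x₁, …, xₙ be strictly positive real numbers and w₁, …, wₙ real numbers such that, for every integer j with 0 ≤ j ≤ 2n − 1, ∫₀^∞ x^j · x^{1/2} e^{−Q(x)} dx = Σ_{k=1}^n w_k · x_k^j. Define the middle weight w₀ = ∫_{−∞}^∞ e^{−Q(t²)} dt − Σ_{k=1}^n w_k/x_k. Then for every integer m with 0 ≤ m ≤ 4n + 1, ∫_{−∞}^∞ t^m e^{−Q(t²)} dt = w₀·0^m + Σ_{k=1}^n (w_k/(2x_k))·((√x_k)^m + (−√x_k)^m), where 0^0 is interpreted as 1. In other words, the (2n+1)-point symmetric rule with nodes 0 and ±√x_k and weights w₀ and w_k/(2x_k) integrates all monomials of degree at most 4n + 1 exactly against the weight function e^{−Q(t²)} on the real line. -/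
open MeasureTheory

/-- The Lebesgue integral of an odd function vanishes. -/
theorem integral_eq_zero_of_comp_neg {f : ℝ → ℝ} (hf : ∀ t, f (-t) = -f t) :
    ∫ t, f t = 0 := by
  have h := integral_neg_eq_self f volume
  simp only [hf, integral_neg] at h
  linarith

/-- Under `s = t ^ 2`, even moments of `g (t ^ 2)` on `ℝ` are half-integer moments of `g`
on `(0, ∞)`. -/
theorem integral_pow_two_mul_succ_mul_comp_sq (g : ℝ → ℝ) (j : ℕ) :
    ∫ t : ℝ, t ^ (2 * (j + 1)) * g (t ^ 2)
      = ∫ s in Set.Ioi (0 : ℝ), s ^ j * s ^ ((1 / 2) : ℝ) * g s := by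
  have habs := integral_comp_abs (f := fun t : ℝ => t ^ (2 * (j + 1)) * g (t ^ 2))
  simp only [pow_mul, sq_abs] at habs
  simp only [pow_mul]
  rw [habs, ← integral_comp_rpow_Ioi_of_pos (g := fun s => s ^ j * s ^ ((1 / 2) : ℝ) * g s)
    (two_pos : (0 : ℝ) < 2), ← integral_const_mul]
  refine setIntegral_congr_fun measurableSet_Ioi fun t ht => ?_
  have ht0 : (0 : ℝ) ≤ t := (Set.mem_Ioi.mp ht).le
  have hsqrt : (t ^ 2) ^ ((1 / 2) : ℝ) = t := by
    rw [← Real.sqrt_eq_rpow, Real.sqrt_sq ht0]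
  have hone : t ^ ((2 : ℝ) - 1) = t := by norm_num
  simp only [smul_eq_mul, Real.rpow_two, hsqrt, hone]
  ring

/-- If the `n`-point rule `(x_k, w_k)` integrates `x^j` exactly against the weight
`x^{1/2} e^{-Q(x)}` on `(0,∞)` for `0 ≤ j ≤ 2n−1`, then the symmetric `(2n+1)`-point rule
with nodes `0, ±√x_k`, middle weight `w₀ = ∫ e^{-Q(t²)} dt − Σ w_k/x_k` and weights
`w_k/(2x_k)`, integrates `t^m` exactly against `e^{-Q(t²)}` on `ℝ` for `0 ≤ m ≤ 4n+1`. -/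
theorem stmt_5 (n : ℕ) (hn : 1 ≤ n) (Q : ℝ → ℝ) (hQmeas : Measurable Q)
    (hint : Integrable (fun t : ℝ => (1 + |t|) ^ (4 * n + 1) * Real.exp (-Q (t ^ 2))))
    (x w : Fin n → ℝ) (hx : ∀ k, 0 < x k)
    (hexact : ∀ j : ℕ, j ≤ 2 * n - 1 →
      ∫ s in Set.Ioi (0 : ℝ), s ^ j * s ^ ((1 / 2) : ℝ) * Real.exp (-Q s)
        = ∑ k, w k * (x k) ^ j)
    (w₀ : ℝ)
    (hw₀ : w₀ = (∫ t : ℝ, Real.exp (-Q (t ^ 2))) - ∑ k, w k / x k) :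
    ∀ m : ℕ, m ≤ 4 * n + 1 →
      ∫ t : ℝ, t ^ m * Real.exp (-Q (t ^ 2))
        = w₀ * (0 : ℝ) ^ m
          + ∑ k, (w k / (2 * x k)) * ((Real.sqrt (x k)) ^ m + (-Real.sqrt (x k)) ^ m) := by
  intro m hm
  obtain ⟨i, rfl | rfl⟩ := m.even_or_odd'
  · cases i with
    | zero =>
      have hsum : ∑ k, w k / (2 * x k) * ((1 : ℝ) + 1) = ∑ k, w k / x k :=
        Finset.sum_congr rfl fun k _ => by
          have := (hx k).ne'
          field_simp
          norm_num
      simp [hsum, hw₀]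
    | succ j =>
      rw [integral_pow_two_mul_succ_mul_comp_sq (fun s => Real.exp (-Q s)),
        hexact j (by omega), zero_pow (by omega), mul_zero, zero_add]
      refine Finset.sum_congr rfl fun k _ => ?_
      have hk := (hx k).ne'
      rw [pow_mul, pow_mul, neg_sq, Real.sq_sqrt (hx k).le]
      field_simp
      ring
  · have hodd : Odd (2 * i + 1) := odd_two_mul_add_one i
    rw [integral_eq_zero_of_comp_neg fun t => by rw [hodd.neg_pow, neg_sq, neg_mul]]
    simp [hodd.neg_pow]
end

section
/- Let n ≥ 1 be an integer, Q : ℝ → ℝ a measurable function, and P a real polynomial of degree n such that x ↦ (1 + x)^n · |P(x)| · x^{−1/2} · e^{−Q(x)} is integrable on (0,∞) and, for every integer j with 0 ≤ j ≤ n − 1, ∫₀^∞ x^j · P(x) · x^{−1/2} · e^{−Q(x)} dx = 0. Then the polynomial t ↦ P(t²) has degree 2n and satisfies, for every integer m with 0 ≤ m ≤ 2n − 1, ∫_{−∞}^∞ t^m · P(t²) · e^{−Q(t²)} dt = 0. That is, P(t²) is orthogonal to all polynomials of degree less than 2n with respect to the weight e^{−Q(t²)} on the real line. -/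
open MeasureTheory Polynomial

/-- The substitution `s = t²` turns even moments on `ℝ` into moments on `(0,∞)` with the additional
weight `s^{-1/2}`. -/
theorem integral_comp_sq (g : ℝ → ℝ) :
    ∫ t : ℝ, g (t ^ 2) = ∫ s in Set.Ioi (0 : ℝ), s ^ (-(1 / 2) : ℝ) * g s := by
  have habs := integral_comp_abs (f := fun t : ℝ => g (t ^ 2))
  simp only [sq_abs] at habs
  rw [habs, ← integral_comp_rpow_Ioi_of_pos (g := fun s => s ^ (-(1 / 2) : ℝ) * g s) two_pos,
    ← integral_const_mul]
  refine setIntegral_congr_fun measurableSet_Ioi fun x (hx : 0 < x) => ?_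
  have h_inv : (x ^ (2 : ℝ)) ^ (-(1 / 2) : ℝ) = x⁻¹ := by
    rw [← Real.rpow_mul hx.le, ← Real.rpow_neg_one]
    norm_num
  have h_lin : x ^ ((2 : ℝ) - 1) = x := by norm_num
  simp only [smul_eq_mul, h_inv, h_lin]
  rw [Real.rpow_two]
  field_simp

/-- The integral of an odd function over `ℝ` vanishes. -/
theorem integral_eq_zero_of_forall_neg {f : ℝ → ℝ} (hf : ∀ t, f (-t) = -f t) :
    ∫ t : ℝ, f t = 0 := by
  have h := integral_neg_eq_self f volume
  simp only [hf, integral_neg] at h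
  linarith

/-- If `P` has degree `n ≥ 1` and is orthogonal to `x^j`, `0 ≤ j ≤ n−1`, with respect to the
modified Laguerre weight `x^{-1/2} e^{-Q(x)}` on `(0,∞)`, then `t ↦ P(t²)` has degree `2n`
and is orthogonal to `t^m`, `0 ≤ m ≤ 2n−1`, with respect to `e^{-Q(t²)}` on `ℝ`. -/
theorem stmt_8 (n : ℕ) (hn : 1 ≤ n) (Q : ℝ → ℝ) (hQmeas : Measurable Q)
    (P : Polynomial ℝ) (hdeg : P.degree = (n : ℕ))
    (hint : IntegrableOn
      (fun s : ℝ => (1 + s) ^ n * |P.eval s| * s ^ (-(1 / 2) : ℝ) * Real.exp (-Q s))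
      (Set.Ioi (0 : ℝ)))
    (horth : ∀ j : ℕ, j ≤ n - 1 →
      ∫ s in Set.Ioi (0 : ℝ), s ^ j * P.eval s * s ^ (-(1 / 2) : ℝ) * Real.exp (-Q s) = 0) :
    (P.comp (Polynomial.X ^ 2)).degree = (2 * n : ℕ) ∧
    ∀ m : ℕ, m ≤ 2 * n - 1 →
      ∫ t : ℝ, t ^ m * P.eval (t ^ 2) * Real.exp (-Q (t ^ 2)) = 0 := by
  constructor
  · have hnat : P.natDegree = n := natDegree_eq_of_degree_eq_some hdeg
    have hcomp : (P.comp (X ^ 2)).natDegree = 2 * n := by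
      rw [natDegree_comp, natDegree_X_pow, hnat, mul_comm]
    rw [degree_eq_iff_natDegree_eq_of_pos (by omega), hcomp]
  · intro m hm
    rcases m.even_or_odd with heven | hodd
    · obtain ⟨j, rfl⟩ := heven.two_dvd
      simp only [pow_mul]
      rw [integral_comp_sq (fun s => s ^ j * P.eval s * Real.exp (-Q s))]
      refine Eq.trans ?_ (horth j (by omega))
      congr 1
      ext s
      ring
    · refine integral_eq_zero_of_forall_neg fun t => ?_
      rw [hodd.neg_pow, neg_sq]
      ring
end

section
/- Let n ≥ 1 be an integer. Let x₁, …, xₙ be pairwise distinct strictly positive real numbers and w₁, …, wₙ real numbers such that, for every integer j with 0 ≤ j ≤ 2n − 1, ∫₀^∞ x^j · x^{1/2} · e^{−x} dx = Σ_{k=1}^n w_k · x_k^j. Then √π − Σ_{k=1}^n w_k / x_k = π · n! / ((2n+1) · Γ(n + 1/2)), where Γ denotes the real Gamma function. Equivalently, the middle weight of the (2n+1)-point Gauss–Hermite quadrature rule equals π·Γ(n+1)/((2n+1)·Γ(n+1/2)). -/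
open MeasureTheory

open Polynomial

theorem Real.Gamma_add_natCast_eq_ascPochhammer_mul {y : ℝ} (hy : 0 < y) (i : ℕ) :
    Real.Gamma (y + i) = (ascPochhammer ℝ i).eval y * Real.Gamma y := by
  induction i with
  | zero => simp
  | succ i ih =>
    rw [Nat.cast_succ, ← add_assoc, Real.Gamma_add_one (by positivity), ih,
      ascPochhammer_succ_eval]
    ring

theorem fwdDiff_iter_inv (n : ℕ) {a : ℝ} (ha : 0 < a) :
    (fwdDiff (1 : ℝ))^[n] (fun r : ℝ ↦ r⁻¹) a
      = (-1) ^ n * n.factorial * Real.Gamma a / Real.Gamma (a + n + 1) := by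
  induction n generalizing a with
  | zero =>
    have := (Real.Gamma_pos_of_pos ha).ne'
    simp only [Function.iterate_zero, id, Nat.cast_zero, add_zero, Real.Gamma_add_one ha.ne',
      pow_zero, Nat.factorial_zero, Nat.cast_one, one_mul]
    field_simp
  | succ n ih =>
    rw [Function.iterate_succ_apply', fwdDiff, ih ha, ih (by positivity),
      Real.Gamma_add_one ha.ne', Nat.cast_succ, show a + 1 + n + 1 = a + n + 1 + 1 by ring,
      show a + (n + 1) + 1 = a + n + 1 + 1 by ring,
      Real.Gamma_add_one (show a + n + 1 ≠ 0 by positivity), Nat.factorial_succ]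
    have : 0 < Real.Gamma (a + n + 1) := Real.Gamma_pos_of_pos (by positivity)
    push_cast
    field_simp
    ring

/-- A linear functional vanishing on `X ^ j` for `1 ≤ j ≤ N` only sees the constant coefficient of
polynomials of degree at most `N`. -/
theorem LinearMap.apply_eq_coeff_zero_mul_of_natDegree_le {R : Type*} [CommRing R]
    (E : R[X] →ₗ[R] R) {N : ℕ}
    (hE : ∀ j, 1 ≤ j → j ≤ N → E (X ^ j) = 0) {f : R[X]} (hf : f.natDegree ≤ N) :
    E f = f.coeff 0 * E 1 := by
  conv_lhs => rw [f.as_sum_range_C_mul_X_pow' (Nat.lt_succ_of_le hf)]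
  simp only [map_sum, ← smul_eq_C_mul, map_smul, smul_eq_mul]
  rw [Finset.sum_range_succ', Finset.sum_eq_zero, zero_add, pow_zero]
  intro j hj
  rw [hE _ (by omega) (by have := Finset.mem_range.mp hj; omega), mul_zero]

/-- The moment functional of the weight `x ^ (-1/2) * exp (-x)` on `(0, ∞)`. -/
noncomputable def halfGammaMoment : ℝ[X] →ₗ[ℝ] ℝ :=
  (Polynomial.basisMonomials ℝ).constr ℝ fun j ↦ Real.Gamma (1 / 2 + j)

theorem halfGammaMoment_X_pow (j : ℕ) : halfGammaMoment (X ^ j) = Real.Gamma (1 / 2 + j) := by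
  have := (Polynomial.basisMonomials ℝ).constr_basis ℝ (fun j : ℕ ↦ Real.Gamma (1 / 2 + j)) j
  simpa only [halfGammaMoment, coe_basisMonomials, monomial_one_right_eq_X_pow] using this

/-- A multiple of the Laguerre polynomial of degree `n` with parameter `1/2`. -/
noncomputable def laguerreHalf (n : ℕ) : ℝ[X] :=
  ∑ k ∈ Finset.range (n + 1),
    C ((((-1) ^ (n - k) * n.choose k : ℤ) : ℝ) / Real.Gamma (1 / 2 + k + 1)) * X ^ k

theorem natDegree_laguerreHalf_le (n : ℕ) : (laguerreHalf n).natDegree ≤ n :=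
  natDegree_sum_le_of_forall_le _ _ fun _ hk ↦
    (natDegree_C_mul_X_pow_le _ _).trans (Nat.lt_succ_iff.mp (Finset.mem_range.mp hk))

theorem coeff_zero_laguerreHalf (n : ℕ) :
    (laguerreHalf n).coeff 0 = (-1) ^ n * 2 / Real.sqrt Real.pi := by
  have h : Real.Gamma (1 / 2 + 1) = 1 / 2 * Real.sqrt Real.pi := by
    rw [Real.Gamma_add_one (by norm_num), Real.Gamma_one_half_eq]
  rw [laguerreHalf, finsetSum_coeff, Finset.sum_range_succ', Finset.sum_eq_zero]
  · simp only [pow_zero, mul_one, coeff_C_zero, Nat.cast_zero, add_zero, h, Nat.sub_zero,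
      Nat.choose_zero_right]
    push_cast
    field_simp
    ring
  · intro k _
    simp

theorem halfGammaMoment_X_pow_mul_laguerreHalf (n j : ℕ) (g : ℝ → ℝ)
    (hg : ∀ k : ℕ, g (1 / 2 + k) = Real.Gamma (1 / 2 + k + j) / Real.Gamma (1 / 2 + k + 1)) :
    halfGammaMoment (X ^ j * laguerreHalf n) = (fwdDiff (1 : ℝ))^[n] g (1 / 2) := by
  rw [fwdDiff_iter_eq_sum_shift, laguerreHalf, Finset.mul_sum, map_sum]
  refine Finset.sum_congr rfl fun k _ ↦ ?_
  rw [mul_left_comm, ← pow_add, ← smul_eq_C_mul, map_smul, halfGammaMoment_X_pow, nsmul_one, hg,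
    smul_eq_mul, zsmul_eq_mul, Nat.cast_add, add_comm (j : ℝ), ← add_assoc]
  ring

theorem halfGammaMoment_X_pow_mul_laguerreHalf_eq_zero {n j : ℕ} (hj : 1 ≤ j) (hjn : j ≤ n) :
    halfGammaMoment (X ^ j * laguerreHalf n) = 0 := by
  obtain ⟨i, rfl⟩ := Nat.exists_eq_add_of_le' hj
  rw [halfGammaMoment_X_pow_mul_laguerreHalf n (i + 1) ((ascPochhammer ℝ i).comp (X + C 1)).eval,
    Polynomial.fwdDiff_iter_eq_zero_of_degree_lt, Pi.zero_apply]
  · rw [natDegree_comp, ascPochhammer_natDegree, natDegree_X_add_C]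
    omega
  · intro k
    have hk : (0 : ℝ) < 1 / 2 + k + 1 := by positivity
    rw [Nat.cast_succ, show (1 / 2 + k + (i + 1) : ℝ) = 1 / 2 + k + 1 + i by ring,
      Real.Gamma_add_natCast_eq_ascPochhammer_mul hk,
      mul_div_cancel_right₀ _ (Real.Gamma_pos_of_pos hk).ne']
    simp

theorem halfGammaMoment_laguerreHalf (n : ℕ) :
    halfGammaMoment (laguerreHalf n)
      = (-1) ^ n * n.factorial * Real.sqrt Real.pi / Real.Gamma (1 / 2 + n + 1) := by
  rw [← Real.Gamma_one_half_eq, ← fwdDiff_iter_inv n (by norm_num : (0 : ℝ) < 1 / 2),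
    ← halfGammaMoment_X_pow_mul_laguerreHalf n 0, pow_zero, one_mul]
  intro k
  have hk : (0 : ℝ) < 1 / 2 + k := by positivity
  have := (Real.Gamma_pos_of_pos hk).ne'
  rw [Real.Gamma_add_one hk.ne', Nat.cast_zero, add_zero]
  field_simp

/-- If `(x_k, w_k)` is the `n`-point Gaussian rule for the weight `x^{1/2} e^{−x}` on
`(0,∞)` (distinct positive nodes, exact up to degree `2n−1`), then the middle weight of the
induced `(2n+1)`-point Gauss–Hermite rule equals `π·Γ(n+1)/((2n+1)·Γ(n+1/2))`:
`√π − Σ w_k/x_k = π·n!/((2n+1)·Γ(n+1/2))`. -/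
theorem stmt_13 (n : ℕ) (hn : 1 ≤ n) (x w : Fin n → ℝ)
    (hx : ∀ k, 0 < x k) (hdist : Function.Injective x)
    (hexact : ∀ j : ℕ, j ≤ 2 * n - 1 →
      ∫ s in Set.Ioi (0 : ℝ), s ^ j * s ^ ((1 / 2) : ℝ) * Real.exp (-s)
        = ∑ k, w k * (x k) ^ j) :
    Real.sqrt Real.pi - ∑ k, w k / x k
      = Real.pi * (Nat.factorial n : ℝ) / ((2 * n + 1) * Real.Gamma (n + 1 / 2)) := by
  have hmoment (j : ℕ) : ∫ s in Set.Ioi (0 : ℝ), s ^ j * s ^ ((1 / 2) : ℝ) * Real.exp (-s)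
      = Real.Gamma (1 / 2 + (j + 1 : ℕ)) := by
    rw [Real.Gamma_eq_integral (by positivity)]
    refine setIntegral_congr_fun measurableSet_Ioi fun s hs ↦ ?_
    have hs : 0 < s := hs
    rw [← Real.rpow_natCast, ← Real.rpow_add hs, mul_comm]
    push_cast
    ring_nf
  set E : ℝ[X] →ₗ[ℝ] ℝ := halfGammaMoment - ∑ k, (w k / x k) • leval (x k) with hE
  have hE_apply (f : ℝ[X]) : E f = halfGammaMoment f - ∑ k, w k / x k * f.eval (x k) := by
    simp [hE, LinearMap.sum_apply]
  have hE_X_pow (j : ℕ) (hj : 1 ≤ j) (hjn : j ≤ n + n) : E (X ^ j) = 0 := by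
    obtain ⟨i, rfl⟩ := Nat.exists_eq_add_of_le' hj
    rw [hE_apply, halfGammaMoment_X_pow, ← hmoment, hexact i (by omega), sub_eq_zero]
    refine Finset.sum_congr rfl fun k _ ↦ ?_
    have := (hx k).ne'
    simp only [eval_pow, eval_X]
    field_simp
    ring
  have hE_one : E 1 = Real.sqrt Real.pi - ∑ k, w k / x k := by
    rw [hE_apply, ← pow_zero X, halfGammaMoment_X_pow]
    simp [← Real.Gamma_one_half_eq]
  set p : ℝ[X] := ∏ k, (X - C (x k)) with hp
  have hp_deg : p.natDegree = n := by simp [hp]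
  have hp_zero : p.coeff 0 ≠ 0 := by
    rw [coeff_zero_eq_eval_zero, hp, eval_prod, Finset.prod_ne_zero_iff]
    intro k _
    simpa using (hx k).ne'
  have hp_eval (k : Fin n) : p.eval (x k) = 0 := by
    rw [hp, eval_prod]
    exact Finset.prod_eq_zero (Finset.mem_univ k) (by simp)
  have h₁ := E.apply_eq_coeff_zero_mul_of_natDegree_le hE_X_pow (f := p * laguerreHalf n)
    (natDegree_mul_le_of_le hp_deg.le (natDegree_laguerreHalf_le n))
  have h₂ := (halfGammaMoment ∘ₗ LinearMap.mulRight ℝ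
    (laguerreHalf n)).apply_eq_coeff_zero_mul_of_natDegree_le (N := n) (f := p)
    (fun j hj hjn ↦ halfGammaMoment_X_pow_mul_laguerreHalf_eq_zero hj hjn) hp_deg.le
  simp only [LinearMap.comp_apply, LinearMap.mulRight_apply, one_mul] at h₂
  simp only [hE_apply (p * _), eval_mul, hp_eval, zero_mul, mul_zero, Finset.sum_const_zero,
    sub_zero] at h₁
  rw [h₂, mul_coeff_zero, mul_assoc, mul_right_inj' hp_zero, halfGammaMoment_laguerreHalf,
    coeff_zero_laguerreHalf, hE_one, Real.Gamma_add_one (by positivity), add_comm (1 / 2)] at h₁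
  have hΓ : 0 < Real.Gamma (n + 1 / 2) := Real.Gamma_pos_of_pos (by positivity)
  have hπ : 0 < Real.sqrt Real.pi := Real.sqrt_pos.mpr Real.pi_pos
  have hsq : Real.sqrt Real.pi ^ 2 = Real.pi := Real.sq_sqrt Real.pi_pos.le
  generalize Real.sqrt Real.pi - ∑ k, w k / x k = W at h₁ ⊢
  have hsign : ((-1 : ℝ) ^ n) ≠ 0 := by simp
  rw [← hsq]
  field_simp at h₁ ⊢
  linarith
end
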